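/- The imaginary quadratic field ℚ(√−163), equal to ℚ[x]/(x² − x + 41), has class number 1. -/

import Mathlib

open NumberField

section Aux

variable {K : Type*} [Field K] [NumberField K]

theorem aux_minpoly (r : K) (hr : r ^ 2 - r + 41 = 0) :
    minpoly ℚ r = Polynomial.X ^ 2 - Polynomial.X + 41 := by
  symm
  have hdeg : (Polynomial.X ^ 2 - Polynomial.X + 41 : Polynomial ℚ).natDegree = 2 := by
    compute_degree!
  have hmon : (Polynomial.X ^ 2 - Polynomial.X + 41 : Polynomial ℚ).Monic := by
    monicity!
  apply minpoly.eq_of_irreducible_of_monic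
  · apply (Polynomial.irreducible_iff_roots_eq_zero_of_degree_le_three (by omega) (by omega)).2
    rw [Multiset.eq_zero_iff_forall_notMem]
    intro a ha
    have := Polynomial.isRoot_of_mem_roots ha
    simp [Polynomial.IsRoot] at this
    nlinarith [sq_nonneg (2 * a - 1)]
  · have : (41 : Polynomial ℚ) = Polynomial.C 41 := rfl
    rw [this]
    simpa using hr
  · exact hmon

theorem aux_trace (hdeg : Module.finrank ℚ K = 2) (r : K) (hr : r ^ 2 - r + 41 = 0) :
    Algebra.trace ℚ K r = 1 := by
  have hm := aux_minpoly r hr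
  have hnat : (Polynomial.X ^ 2 - Polynomial.X + 41 : Polynomial ℚ).natDegree = 2 := by
    compute_degree!
  have hint : IsIntegral ℚ r := Algebra.IsIntegral.isIntegral r
  have h1 := IntermediateField.adjoin.finrank hint
  rw [hm, hnat] at h1
  have h2 := Module.finrank_mul_finrank ℚ (IntermediateField.adjoin ℚ {r}) K
  rw [h1, hdeg] at h2
  have h3 : Module.finrank (IntermediateField.adjoin ℚ {r}) K = 1 := by omega
  rw [trace_eq_finrank_mul_minpoly_nextCoeff, h3, hm,
    Polynomial.nextCoeff_of_natDegree_pos (by omega), hnat]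
  have : (Polynomial.X ^ 2 - Polynomial.X + 41 : Polynomial ℚ).coeff 1 = -1 := by
    have : (41 : Polynomial ℚ) = Polynomial.C 41 := rfl
    rw [this]
    simp [Polynomial.coeff_X]
  simp [this]

theorem aux_discr (hdeg : Module.finrank ℚ K = 2) (r : K) (hr : r ^ 2 - r + 41 = 0) :
    |discr K| ≤ 163 := by
  have hc : Fintype.card (Module.Free.ChooseBasisIndex ℤ (𝓞 K)) = Fintype.card (Fin 2) := by
    rw [← Module.finrank_eq_card_chooseBasisIndex, RingOfIntegers.rank, hdeg]; rfl
  let e := Fintype.equivOfCardEq hc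
  let b := (integralBasis K).reindex e
  have hb : Algebra.discr ℚ b = discr K := by
    rw [coe_discr, Module.Basis.coe_reindex, Algebra.discr_reindex]
  have hint : IsIntegral ℤ r := by
    refine ⟨Polynomial.X ^ 2 - Polynomial.X + 41, by monicity!, ?_⟩
    simpa using hr
  let v : Fin 2 → K := ![1, r]
  have hv : ∀ i, IsIntegral ℤ (v i) := by
    intro i
    fin_cases i
    · exact isIntegral_one
    · exact hint
  have hd : Algebra.discr ℚ v = -163 := by
    have ht := aux_trace hdeg r hr
    have h1 : Algebra.trace ℚ K 1 = 2 := by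
      rw [← map_one (algebraMap ℚ K), Algebra.trace_algebraMap, hdeg]; simp
    have h2 : Algebra.trace ℚ K (r * r) = -81 := by
      have : r * r = r - (41 : ℚ) • 1 := by
        rw [Algebra.smul_def]; simp; linear_combination hr
      rw [this, map_sub, map_smul, ht, h1]; norm_num
    rw [Algebra.discr_def, Matrix.det_fin_two]
    simp [Algebra.traceMatrix_apply, Algebra.traceForm_apply, v, ht, h1, h2]
    norm_num
  have hP : ∃ P : Matrix (Fin 2) (Fin 2) ℤ, b.toMatrix v = P.map (Int.cast : ℤ → ℚ) := by
    have : ∀ i j, ∃ z : ℤ, (z : ℚ) = b.toMatrix v i j := by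
      intro i j
      refine ⟨(RingOfIntegers.basis K).repr ⟨v j, hv j⟩ (e.symm i), ?_⟩
      have := integralBasis_repr_apply K ⟨v j, hv j⟩ (e.symm i)
      simp only [Module.Basis.toMatrix_apply, b, Module.Basis.repr_reindex]
      simp
      exact this.symm
    choose P hP using this
    exact ⟨Matrix.of P, by ext i j; simp [hP]⟩
  obtain ⟨P, hP⟩ := hP
  have key := Algebra.discr_of_matrix_vecMul (A := ℚ) b (b.toMatrix v)
  rw [Module.Basis.toMatrix_map_vecMul, hd, hb, hP] at key
  have hdet : (P.map (Int.cast : ℤ → ℚ)).det = (P.det : ℚ) := by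
    simp [Matrix.det_fin_two]
  rw [hdet] at key
  have key' : -163 = P.det ^ 2 * discr K := by exact_mod_cast key
  have : discr K ∣ 163 := ⟨- P.det ^ 2, by linarith⟩
  have := (abs_dvd _ _).2 this
  exact Int.le_of_dvd (by norm_num) this

theorem aux_prime (hdeg : Module.finrank ℚ K = 2) (r : K) (hr : r ^ 2 - r + 41 = 0)
    (P : Ideal (𝓞 K)) (hP : P.IsPrime) (hP0 : P ≠ ⊥) (hN : Ideal.absNorm P ≤ 8) :
    Submodule.IsPrincipal P := by
  have hint : IsIntegral ℤ r := by
    refine ⟨Polynomial.X ^ 2 - Polynomial.X + 41, by monicity!, ?_⟩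
    simpa using hr
  let θ : 𝓞 K := ⟨r, hint⟩
  have hθ : θ ^ 2 - θ + 41 = 0 := by
    apply RingOfIntegers.ext
    have h41 : algebraMap (𝓞 K) K 41 = 41 := map_ofNat _ 41
    have hr' : algebraMap (𝓞 K) K θ = r := rfl
    change algebraMap (𝓞 K) K (θ ^ 2 - θ + 41) = algebraMap (𝓞 K) K 0
    rw [map_add, map_sub, map_pow, h41, hr', map_zero, hr]
  have hmax : P.IsMaximal := hP.isMaximal hP0
  obtain ⟨p, n, hn, hpP, hp, hNP⟩ := Ideal.exists_prime_and_absNorm_eq_pow P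
  have hle : Ideal.span {(p : 𝓞 K)} ≤ P := (Ideal.span_singleton_le_iff_mem P).2 hpP
  obtain ⟨J, hJ⟩ := Ideal.dvd_iff_le.2 hle
  have hNp : Ideal.absNorm (Ideal.span {(p : 𝓞 K)}) = p ^ 2 := by
    rw [Ideal.absNorm_span_natCast, RingOfIntegers.rank, hdeg]
  have hmul : p ^ n * Ideal.absNorm J = p ^ 2 := by
    rw [← hNP, ← map_mul, ← hJ, hNp]
  have hn2 : n ≤ 2 := (Nat.pow_dvd_pow_iff_le_right hp.one_lt).1 ⟨_, hmul.symm⟩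
  have hn1 : n ≠ 1 := by
    -- the residue field would be `ZMod p`, but `x² - x + 41` has no root there
    rintro rfl
    rw [pow_one] at hNP
    have hcard : Nat.card (𝓞 K ⧸ P) = p := hNP
    have : Finite (𝓞 K ⧸ P) := Nat.finite_of_card_ne_zero (by rw [hcard]; exact hp.ne_zero)
    let := Fintype.ofFinite (𝓞 K ⧸ P)
    let f : 𝓞 K →+* ZMod p :=
      (ZMod.ringEquivOfPrime (𝓞 K ⧸ P) hp
        (by rw [← Nat.card_eq_fintype_card, hcard])).symm.toRingHom.comp (Ideal.Quotient.mk P)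
    have hf : f θ ^ 2 - f θ + 41 = 0 := by
      have := congrArg f hθ
      rwa [map_add, map_sub, map_pow, map_ofNat, map_zero] at this
    have hp8 : p ≤ 8 := by omega
    generalize f θ = x at hf
    clear * - hf hp8 hp
    interval_cases p
    all_goals first
      | (revert x; decide)
      | (exact absurd hp (by norm_num))
  have hn' : n = 2 := by omega
  subst hn'
  have hJ1 : Ideal.absNorm J = 1 :=
    Nat.eq_of_mul_eq_mul_left (pow_pos hp.pos 2) (by rw [hmul, mul_one])
  rw [Ideal.absNorm_eq_one_iff] at hJ1
  rw [hJ1, Ideal.mul_top] at hJ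
  exact ⟨⟨p, hJ.symm⟩⟩

theorem aux_M (hdeg : Module.finrank ℚ K = 2) (r : K) (hr : r ^ 2 - r + 41 = 0) :
    (4 / Real.pi) ^ InfinitePlace.nrComplexPlaces K *
      ((Module.finrank ℚ K).factorial / (Module.finrank ℚ K) ^ (Module.finrank ℚ K) *
        √|(discr K : ℝ)|) < 9 := by
  have hd := aux_discr hdeg r hr
  have hd' : |(discr K : ℝ)| ≤ 163 := by exact_mod_cast hd
  have hs : √|(discr K : ℝ)| ≤ 13 := by
    rw [Real.sqrt_le_left (by norm_num)]; linarith
  have hc : InfinitePlace.nrComplexPlaces K ≤ 1 := by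
    have := InfinitePlace.card_add_two_mul_card_eq_rank K
    omega
  have hpi : 4 / Real.pi ≤ 4 / 3 := by
    gcongr
    exact Real.pi_gt_three.le
  have hpow : (4 / Real.pi) ^ InfinitePlace.nrComplexPlaces K ≤ 4 / 3 := by
    have h0 : 0 ≤ 4 / Real.pi := by positivity
    interval_cases InfinitePlace.nrComplexPlaces K
    · norm_num
    · simpa using hpi
  rw [hdeg]
  calc _ ≤ (4 / 3 : ℝ) * (((2 : ℕ).factorial : ℝ) / ((2 : ℕ) : ℝ) ^ 2 * 13) := by gcongr
    _ < 9 := by norm_num [Nat.factorial]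

end Aux

/-- Any number field of degree 2 over `ℚ` containing a root of `x² - x + 41`
(i.e. `ℚ(√-163)`) has class number one. -/
theorem classNumber_sqrt_neg_163_eq_one (K : Type*) [Field K] [NumberField K]
    (hdeg : Module.finrank ℚ K = 2) (r : K) (hr : r ^ 2 - r + 41 = 0) :
    classNumber K = 1 := by
  rw [classNumber_eq_one_iff]
  apply RingOfIntegers.isPrincipalIdealRing_of_isPrincipal_of_norm_le_of_isPrime
  intro I hI hN
  refine aux_prime hdeg r hr _ hI (nonZeroDivisors.coe_ne_zero I) ?_
  have h := lt_of_le_of_lt hN (aux_M hdeg r hr)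
  have h' : Ideal.absNorm (I : Ideal (𝓞 K)) < 9 := by exact_mod_cast h
  omega
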